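/- arXiv:quant-ph/0505090 — 2 statements merged into one kernel-verified Lean document; each statement's English description precedes it below -/
import Mathlib

section
/- Let I be an instrument with finite outcome set Ω, operations O(ω), POV measure E and outcome probabilities p_ρ(ω) = Tr(E(ω)ρ). Let ρ be a density matrix and φ a positive definite density matrix. Then S_q(ρ‖φ) ≥ S_c(p_ρ‖p_φ) + Σ_{ω: p_ρ(ω)>0} p_ρ(ω) S_q(π_ρ(ω)‖π_φ(ω)), where π_ρ(ω) = O(ω)[ρ]/p_ρ(ω) and π_φ(ω) = O(ω)[φ]/p_φ(ω) are the a posteriori states. -/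
open Matrix Finset
open scoped BigOperators ComplexOrder

noncomputable section

/-- Matrix logarithm of a Hermitian matrix via the spectral decomposition
(with the convention `Real.log 0 = 0` on the kernel); `0` for non-Hermitian matrices. -/
def matLog {d : ℕ} (A : Matrix (Fin d) (Fin d) ℂ) : Matrix (Fin d) (Fin d) ℂ :=
  if hA : A.IsHermitian then
    (hA.eigenvectorUnitary : Matrix (Fin d) (Fin d) ℂ) *
      Matrix.diagonal (fun i => (Real.log (hA.eigenvalues i) : ℂ)) *
      star (hA.eigenvectorUnitary : Matrix (Fin d) (Fin d) ℂ)
  else 0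

/-- The von Neumann entropy `S_q(ρ) = −Tr(ρ log ρ)`. -/
def vnEntropy {d : ℕ} (ρ : Matrix (Fin d) (Fin d) ℂ) : ℝ :=
  -(Matrix.trace (ρ * matLog ρ)).re

/-- The quantum relative entropy `S_q(ρ‖φ) = Tr(ρ (log ρ − log φ))`. -/
def qRelEntropy {d : ℕ} (ρ φ : Matrix (Fin d) (Fin d) ℂ) : ℝ :=
  (Matrix.trace (ρ * (matLog ρ - matLog φ))).re

/-- The classical relative entropy `S_c(p‖q) = Σ_{ω : p ω > 0} p ω log (p ω / q ω)`. -/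
def cRelEntropy {Ω : Type*} [Fintype Ω] (p q : Ω → ℝ) : ℝ :=
  ∑ ω ∈ Finset.univ.filter (fun ω => 0 < p ω), p ω * Real.log (p ω / q ω)

/-- The probability of outcome `ω` for POV measure `E` in the state `ρ`. -/
def povProb {d : ℕ} {Ω : Type*} (E : Ω → Matrix (Fin d) (Fin d) ℂ)
    (ρ : Matrix (Fin d) (Fin d) ℂ) (ω : Ω) : ℝ :=
  (Matrix.trace (E ω * ρ)).re

/-- The χ-quantity of the ensemble `{p, σ}` (relative entropies w.r.t. the average state). -/
def chiQuantity {d : ℕ} {X : Type*} [Fintype X] (p : X → ℝ)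
    (σ : X → Matrix (Fin d) (Fin d) ℂ) : ℝ :=
  ∑ x ∈ Finset.univ.filter (fun x => 0 < p x),
    p x * qRelEntropy (σ x) (∑ y, p y • σ y)

/-- The operation `O(ω)[ρ] = Σ_k V_k^ω ρ (V_k^ω)†` of the instrument with Kraus family `V`. -/
def instrOp {d : ℕ} {Ω K : Type*} [Fintype K] (V : Ω → K → Matrix (Fin d) (Fin d) ℂ)
    (ω : Ω) (ρ : Matrix (Fin d) (Fin d) ℂ) : Matrix (Fin d) (Fin d) ℂ :=
  ∑ k, V ω k * ρ * (V ω k)ᴴ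

/-- The POV measure `E(ω) = Σ_k (V_k^ω)† V_k^ω` associated with the instrument `V`. -/
def instrPOV {d : ℕ} {Ω K : Type*} [Fintype K] (V : Ω → K → Matrix (Fin d) (Fin d) ℂ)
    (ω : Ω) : Matrix (Fin d) (Fin d) ℂ :=
  ∑ k, (V ω k)ᴴ * V ω k

/-- The outcome probability `p_ρ(ω) = Tr(E(ω) ρ)` of the instrument `V`. -/
def outcomeProb {d : ℕ} {Ω K : Type*} [Fintype K] (V : Ω → K → Matrix (Fin d) (Fin d) ℂ)
    (ρ : Matrix (Fin d) (Fin d) ℂ) (ω : Ω) : ℝ :=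
  (Matrix.trace (instrPOV V ω * ρ)).re

/-- The a posteriori state `π_ρ(ω) = O(ω)[ρ] / p_ρ(ω)` of the instrument `V`. -/
def postState {d : ℕ} {Ω K : Type*} [Fintype K] (V : Ω → K → Matrix (Fin d) (Fin d) ℂ)
    (ρ : Matrix (Fin d) (Fin d) ℂ) (ω : Ω) : Matrix (Fin d) (Fin d) ℂ :=
  (outcomeProb V ρ ω)⁻¹ • instrOp V ω ρ

/-- The classical input/output mutual information `I_c{p, ρ; E}` for the ensemble `{p, ρ}`
measured with the POV measure `E`. -/
def mutualInfo {d : ℕ} {A Ω : Type*} [Fintype A] [Fintype Ω]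
    (p : A → ℝ) (ρ : A → Matrix (Fin d) (Fin d) ℂ)
    (E : Ω → Matrix (Fin d) (Fin d) ℂ) : ℝ :=
  ∑ x ∈ Finset.univ.filter (fun x : A × Ω => 0 < p x.1 * povProb E (ρ x.1) x.2),
    (p x.1 * povProb E (ρ x.1) x.2) *
      Real.log ((p x.1 * povProb E (ρ x.1) x.2) /
        (p x.1 * povProb E (∑ α, p α • ρ α) x.2))

/-- The quantum information gain `I_q(ρ; I)` of the instrument `V` on the state `ρ`. -/
def infoGain {d : ℕ} {Ω K : Type*} [Fintype Ω] [Fintype K]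
    (V : Ω → K → Matrix (Fin d) (Fin d) ℂ) (ρ : Matrix (Fin d) (Fin d) ℂ) : ℝ :=
  vnEntropy ρ - ∑ ω ∈ Finset.univ.filter (fun ω => 0 < outcomeProb V ρ ω),
    outcomeProb V ρ ω * vnEntropy (postState V ρ ω)

/-- A pure state: a rank-one orthogonal projection. -/
def IsPureState {d : ℕ} (ρ : Matrix (Fin d) (Fin d) ℂ) : Prop :=
  ρ.IsHermitian ∧ ρ * ρ = ρ ∧ ρ.rank = 1

end

section Scalar

/-- The derivative of `t ↦ ∑ c a log (b + t a)` on the nonnegative half-line. -/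
theorem hasDerivAt_sum_mul_log {L : Type*} [Fintype L] (c a b : L → ℝ) (ha : ∀ i, 0 ≤ a i)
    (hab : ∀ i, c i * a i ≠ 0 → 0 < b i) (t : ℝ) (ht : 0 ≤ t) :
    HasDerivAt (fun s : ℝ => ∑ i, c i * a i * Real.log (b i + s * a i))
      (∑ i, c i * (a i ^ 2 / (b i + t * a i))) t := by
  refine HasDerivAt.fun_sum fun i _ => ?_
  by_cases h : c i * a i = 0
  · have h2 : c i * (a i ^ 2 / (b i + t * a i)) = 0 := by
      rw [show c i * (a i ^ 2 / (b i + t * a i)) = c i * a i * (a i / (b i + t * a i)) by ring,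
        h, zero_mul]
    simp only [h, h2, zero_mul]
    exact hasDerivAt_const _ _
  · have hpos : 0 < b i + t * a i :=
      add_pos_of_pos_of_nonneg (hab i h) (mul_nonneg ht (ha i))
    have h1 : HasDerivAt (fun s : ℝ => b i + s * a i) (a i) t := by
      simpa using ((hasDerivAt_id t).mul_const (a i)).const_add (b i)
    refine ((h1.log hpos.ne').const_mul (c i * a i)).congr_deriv ?_
    ring

theorem tendsto_sum_mul_log_sub {L : Type*} [Fintype L] (c a b : L → ℝ) (ha : ∀ i, 0 ≤ a i)
    (hab : ∀ i, c i * a i ≠ 0 → 0 < b i) :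
    Filter.Tendsto (fun s : ℝ => ∑ i, c i * a i * Real.log (b i + s * a i) -
      (∑ i, c i * a i) * Real.log s) Filter.atTop (nhds (∑ i, c i * a i * Real.log (a i))) := by
  have key : Filter.Tendsto
      (fun s : ℝ => ∑ i, c i * a i * (Real.log (b i + s * a i) - Real.log s)) Filter.atTop
      (nhds (∑ i, c i * a i * Real.log (a i))) := by
    refine tendsto_finsetSum _ fun i _ => ?_
    by_cases h : c i * a i = 0
    · simp [h]
    · have hai : 0 < a i := (ha i).lt_of_ne' fun h0 => h (by simp [h0])
      refine Filter.Tendsto.const_mul _ ?_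
      have h1 : Filter.Tendsto (fun s : ℝ => b i / s + a i) Filter.atTop (nhds (a i)) := by
        simpa using (Filter.Tendsto.const_div_atTop (r := b i) Filter.tendsto_id).add_const (a i)
      refine (h1.log hai.ne').congr' ?_
      filter_upwards [Filter.eventually_gt_atTop 0] with s hs
      rw [← Real.log_div _ hs.ne']
      · congr 1
        field_simp
      · exact (add_pos (hab i h) (mul_pos hs hai)).ne'
  refine key.congr fun s => ?_
  simp only [mul_sub, Finset.sum_sub_distrib, Finset.sum_mul]

/-- If the resolvent-type sums of two families of weighted pairs `(a, b)` are ordered, so are their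
relative entropies: the entropy difference is an integral of resolvent differences. -/
theorem sum_entropy_le_of_sum_resolvent_le {I J : Type*} [Fintype I] [Fintype J]
    (c a b : I → ℝ) (c' a' b' : J → ℝ)
    (ha : ∀ i, 0 ≤ a i) (hab : ∀ i, c i * a i ≠ 0 → 0 < b i)
    (ha' : ∀ j, 0 ≤ a' j) (hab' : ∀ j, c' j * a' j ≠ 0 → 0 < b' j)
    (hsum : ∑ i, c i * a i = ∑ j, c' j * a' j)
    (hres : ∀ t : ℝ, 0 < t → ∑ j, c' j * (a' j ^ 2 / (b' j + t * a' j)) ≤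
      ∑ i, c i * (a i ^ 2 / (b i + t * a i))) :
    ∑ j, c' j * a' j * (Real.log (a' j) - Real.log (b' j)) ≤
      ∑ i, c i * a i * (Real.log (a i) - Real.log (b i)) := by
  set G : ℝ → ℝ := fun s => ∑ i, c i * a i * Real.log (b i + s * a i) -
    ∑ j, c' j * a' j * Real.log (b' j + s * a' j) with hG
  have hGd : ∀ t : ℝ, 0 ≤ t → HasDerivAt G (∑ i, c i * (a i ^ 2 / (b i + t * a i)) -
      ∑ j, c' j * (a' j ^ 2 / (b' j + t * a' j))) t := fun t ht =>
    (hasDerivAt_sum_mul_log c a b ha hab t ht).sub (hasDerivAt_sum_mul_log c' a' b' ha' hab' t ht)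
  have hmono : MonotoneOn G (Set.Ici 0) := by
    refine monotoneOn_of_deriv_nonneg (convex_Ici 0)
      (fun t ht => (hGd t ht).continuousAt.continuousWithinAt)
      (fun t ht => ?_) (fun t ht => ?_)
    · rw [interior_Ici] at ht
      exact (hGd t ht.le).differentiableAt.differentiableWithinAt
    · rw [interior_Ici] at ht
      rw [(hGd t ht.le).deriv]
      exact sub_nonneg.2 (hres t ht)
  have hlim : Filter.Tendsto G Filter.atTop
      (nhds (∑ i, c i * a i * Real.log (a i) - ∑ j, c' j * a' j * Real.log (a' j))) := by
    refine ((tendsto_sum_mul_log_sub c a b ha hab).sub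
      (tendsto_sum_mul_log_sub c' a' b' ha' hab')).congr fun s => ?_
    rw [hsum, hG]
    ring
  have h0 : G 0 ≤ ∑ i, c i * a i * Real.log (a i) - ∑ j, c' j * a' j * Real.log (a' j) := by
    refine ge_of_tendsto hlim ?_
    filter_upwards [Filter.eventually_ge_atTop 0] with s hs
    exact hmono Set.self_mem_Ici hs hs
  simp only [hG, zero_mul, add_zero] at h0
  simp only [mul_sub, Finset.sum_sub_distrib]
  linarith

end Scalar

section Variational

variable {n : Type*} [Fintype n]

/-- The concave functional of `X` whose supremum is the resolvent form of the relative modular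
operator of `(A, B)` at `t`. -/
def resolventForm (t : ℝ) (A B X : Matrix n n ℂ) : ℝ :=
  2 * (X * A).trace.re - (X * Xᴴ * B).trace.re - t * (Xᴴ * X * A).trace.re

theorem resolventForm_sum {K : Type*} [Fintype K] (t : ℝ) (A B : K → Matrix n n ℂ)
    (X : Matrix n n ℂ) :
    resolventForm t (∑ k, A k) (∑ k, B k) X = ∑ k, resolventForm t (A k) (B k) X := by
  simp only [resolventForm, Finset.mul_sum, Matrix.trace_sum, Complex.re_sum,
    Finset.sum_sub_distrib]

/-- Kadison–Schwarz inequality for a unital Kraus map, tested against a state. -/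
theorem trace_kraus_schwarz [DecidableEq n] {ι : Type*} [Fintype ι] (V Y : ι → Matrix n n ℂ)
    (hV : ∑ k, (V k)ᴴ * V k = 1) {σ : Matrix n n ℂ} (hσ : σ.PosSemidef) :
    ((∑ k, (V k)ᴴ * Y k * V k) * (∑ k, (V k)ᴴ * Y k * V k)ᴴ * σ).trace.re ≤
      ∑ k, (Y k * (Y k)ᴴ * (V k * σ * (V k)ᴴ)).trace.re := by
  set M := ∑ k, (V k)ᴴ * Y k * V k with hM
  have hMc : Mᴴ = ∑ k, (V k)ᴴ * (Y k)ᴴ * V k := by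
    simp [hM, Matrix.conjTranspose_sum, Matrix.mul_assoc]
  have expand : ∑ k, ((V k)ᴴ * Y k - M * (V k)ᴴ) * ((V k)ᴴ * Y k - M * (V k)ᴴ)ᴴ =
      ∑ k, (V k)ᴴ * (Y k * (Y k)ᴴ) * V k - M * Mᴴ := by
    have : ∀ k, ((V k)ᴴ * Y k - M * (V k)ᴴ) * ((V k)ᴴ * Y k - M * (V k)ᴴ)ᴴ =
        (V k)ᴴ * (Y k * (Y k)ᴴ) * V k - ((V k)ᴴ * Y k * V k) * Mᴴ
          - M * ((V k)ᴴ * (Y k)ᴴ * V k) + M * ((V k)ᴴ * V k) * Mᴴ := by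
      intro k
      simp only [Matrix.conjTranspose_sub, Matrix.conjTranspose_mul,
        Matrix.conjTranspose_conjTranspose]
      noncomm_ring
    simp only [this, Finset.sum_add_distrib, Finset.sum_sub_distrib, ← Finset.sum_mul,
      ← Finset.mul_sum, hV, ← hMc, ← hM]
    noncomm_ring
  have nonneg : 0 ≤ ((∑ k, (V k)ᴴ * (Y k * (Y k)ᴴ) * V k - M * Mᴴ) * σ).trace.re := by
    rw [← expand, Finset.sum_mul, Matrix.trace_sum, Complex.re_sum]
    refine Finset.sum_nonneg fun k _ => ?_
    rw [← Matrix.trace_mul_cycle]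
    exact (Complex.le_def.1 (hσ.conjTranspose_mul_mul_same _).trace_nonneg).1
  rw [Matrix.sub_mul, Matrix.trace_sub, Complex.sub_re, sub_nonneg,
    Finset.sum_mul univ (fun k => (V k)ᴴ * (Y k * (Y k)ᴴ) * V k), Matrix.trace_sum,
    Complex.re_sum] at nonneg
  refine nonneg.trans (Finset.sum_le_sum fun k _ => le_of_eq ?_)
  rw [Matrix.mul_assoc, Matrix.mul_assoc, Matrix.trace_mul_comm]
  simp only [Matrix.mul_assoc]

theorem sum_resolventForm_kraus_le [DecidableEq n] {ι : Type*} [Fintype ι]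
    (V Y : ι → Matrix n n ℂ) (hV : ∑ k, (V k)ᴴ * V k = 1) {t : ℝ} (ht : 0 ≤ t)
    {A B : Matrix n n ℂ} (hA : A.PosSemidef) (hB : B.PosSemidef) :
    ∑ k, resolventForm t (V k * A * (V k)ᴴ) (V k * B * (V k)ᴴ) (Y k) ≤
      resolventForm t A B (∑ k, (V k)ᴴ * Y k * V k) := by
  have h1 := trace_kraus_schwarz V Y hV hB
  have h2 := trace_kraus_schwarz V (fun k => (Y k)ᴴ) hV hA
  have hMc : (∑ k, (V k)ᴴ * Y k * V k)ᴴ = ∑ k, (V k)ᴴ * (Y k)ᴴ * V k := by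
    simp [Matrix.conjTranspose_sum, Matrix.mul_assoc]
  rw [← hMc] at h2
  simp only [Matrix.conjTranspose_conjTranspose] at h2
  have h3 : ((∑ k, (V k)ᴴ * Y k * V k) * A).trace.re =
      ∑ k, (Y k * (V k * A * (V k)ᴴ)).trace.re := by
    rw [Finset.sum_mul, Matrix.trace_sum, Complex.re_sum]
    refine Finset.sum_congr rfl fun k _ => ?_
    rw [Matrix.mul_assoc, Matrix.mul_assoc, Matrix.trace_mul_comm]
    simp only [Matrix.mul_assoc]
  simp only [resolventForm, Finset.sum_sub_distrib, ← Finset.mul_sum, h3]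
  have h4 := mul_le_mul_of_nonneg_left h2 ht
  linarith

variable [DecidableEq n]

/-- `A` is diagonalised by the unitary `U`, with nonnegative eigenvalues `a`. -/
structure IsDiagonalizedBy (A U : Matrix n n ℂ) (a : n → ℝ) : Prop where
  conjTranspose_mul_self : Uᴴ * U = 1
  eigenvalues_nonneg : ∀ i, 0 ≤ a i
  eq_conj : A = U * diagonal (fun i => (a i : ℂ)) * Uᴴ

/-- The squared overlaps of the columns of `U` and `W`. -/
def overlap (U W : Matrix n n ℂ) (i j : n) : ℝ := Complex.normSq ((Uᴴ * W) i j)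

theorem sum_overlap {U W : Matrix n n ℂ} (hU : Uᴴ * U = 1) (hW : Wᴴ * W = 1) (i : n) :
    ∑ j, overlap U W i j = 1 := by
  have hW' : W * Wᴴ = 1 := mul_eq_one_comm.1 hW
  have h : (Uᴴ * W) * (Uᴴ * W)ᴴ = 1 := by
    rw [conjTranspose_mul, conjTranspose_conjTranspose, Matrix.mul_assoc, ← Matrix.mul_assoc W,
      hW', Matrix.one_mul, hU]
  have h2 := congrFun (congrFun h i) i
  rw [Matrix.mul_apply, Matrix.one_apply_eq] at h2
  have h3 := congrArg Complex.re h2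
  simpa [overlap, Complex.normSq_apply] using h3

theorem trace_conj_diagonal_mul (U W : Matrix n n ℂ) (a f : n → ℝ) :
    (U * diagonal (fun i => (a i : ℂ)) * Uᴴ *
      (W * diagonal (fun i => (f i : ℂ)) * Wᴴ)).trace.re =
      ∑ i, ∑ j, overlap U W i j * a i * f j := by
  have h : (U * diagonal (fun i => (a i : ℂ)) * Uᴴ *
      (W * diagonal (fun i => (f i : ℂ)) * Wᴴ)).trace =
      (diagonal (fun i => (a i : ℂ)) * (Uᴴ * W) * diagonal (fun i => (f i : ℂ)) *
        (Uᴴ * W)ᴴ).trace := by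
    rw [conjTranspose_mul, conjTranspose_conjTranspose, Matrix.mul_assoc, Matrix.mul_assoc,
      Matrix.trace_mul_comm]
    simp only [Matrix.mul_assoc]
  rw [h]
  simp only [Matrix.trace, Matrix.diag_apply, Complex.re_sum]
  refine Finset.sum_congr rfl fun i _ => ?_
  rw [Matrix.mul_apply, Complex.re_sum]
  refine Finset.sum_congr rfl fun j _ => ?_
  rw [Matrix.mul_diagonal, Matrix.diagonal_mul, conjTranspose_apply]
  simp only [overlap, Complex.normSq_apply, Complex.star_def, Complex.mul_re, Complex.mul_im,
    Complex.conj_re, Complex.conj_im, Complex.ofReal_re, Complex.ofReal_im]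
  ring

namespace IsDiagonalizedBy

variable {A B U W : Matrix n n ℂ} {a b : n → ℝ}

theorem resolventForm_conj (hA : IsDiagonalizedBy A U a) (hB : IsDiagonalizedBy B W b) (t : ℝ)
    (Y : Matrix n n ℂ) :
    resolventForm t A B (W * Y * Uᴴ) = ∑ i, ∑ j,
      (2 * ((Uᴴ * W) i j * Y j i).re * a i - Complex.normSq (Y j i) * (b j + t * a i)) := by
  have hU : ∀ M, Uᴴ * (U * M) = M := fun M => by
    rw [← Matrix.mul_assoc, hA.conjTranspose_mul_self, Matrix.one_mul]
  have hW : ∀ M, Wᴴ * (W * M) = M := fun M => by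
    rw [← Matrix.mul_assoc, hB.conjTranspose_mul_self, Matrix.one_mul]
  have h1 : (W * Y * Uᴴ * A).trace =
      (diagonal (fun i => (a i : ℂ)) * (Uᴴ * W) * Y).trace := by
    rw [hA.eq_conj]
    simp only [Matrix.mul_assoc, hU]
    rw [← Matrix.mul_assoc, Matrix.trace_mul_comm]
    simp only [Matrix.mul_assoc]
  have h2 : (W * Y * Uᴴ * (W * Y * Uᴴ)ᴴ * B).trace =
      (diagonal (fun j => (b j : ℂ)) * Y * Yᴴ).trace := by
    rw [hB.eq_conj]
    simp only [conjTranspose_mul, conjTranspose_conjTranspose, Matrix.mul_assoc, hU, hW]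
    rw [Matrix.trace_mul_comm]
    simp only [Matrix.mul_assoc, hB.conjTranspose_mul_self, Matrix.mul_one]
    rw [← Matrix.mul_assoc, Matrix.trace_mul_comm]
  have h3 : ((W * Y * Uᴴ)ᴴ * (W * Y * Uᴴ) * A).trace =
      (diagonal (fun i => (a i : ℂ)) * Yᴴ * Y).trace := by
    rw [hA.eq_conj]
    simp only [conjTranspose_mul, conjTranspose_conjTranspose, Matrix.mul_assoc, hU, hW]
    rw [Matrix.trace_mul_comm]
    simp only [Matrix.mul_assoc, hA.conjTranspose_mul_self, Matrix.mul_one]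
    rw [← Matrix.mul_assoc, Matrix.trace_mul_comm]
  have e1 : (diagonal (fun i => (a i : ℂ)) * (Uᴴ * W) * Y).trace.re =
      ∑ i, ∑ j, ((Uᴴ * W) i j * Y j i).re * a i := by
    simp only [Matrix.trace, Matrix.diag_apply, Complex.re_sum]
    refine Finset.sum_congr rfl fun i _ => ?_
    rw [Matrix.mul_apply, Complex.re_sum]
    refine Finset.sum_congr rfl fun j _ => ?_
    rw [Matrix.diagonal_mul, _root_.mul_assoc, Complex.re_ofReal_mul, mul_comm]
  have e2 : ∀ (f : n → ℝ) (Y : Matrix n n ℂ), (diagonal (fun i => (f i : ℂ)) * Y * Yᴴ).trace.re =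
      ∑ i, ∑ j, Complex.normSq (Y i j) * f i := by
    intro f Y
    simp only [Matrix.trace, Matrix.diag_apply, Complex.re_sum]
    refine Finset.sum_congr rfl fun i _ => ?_
    rw [Matrix.mul_apply, Complex.re_sum]
    refine Finset.sum_congr rfl fun j _ => ?_
    rw [Matrix.diagonal_mul, _root_.mul_assoc, Complex.re_ofReal_mul, mul_comm,
      conjTranspose_apply, Complex.star_def, Complex.mul_conj, Complex.ofReal_re]
  have e3 := e2 a Yᴴ
  rw [conjTranspose_conjTranspose] at e3
  rw [resolventForm, h1, h2, h3, e1, e2, e3, Finset.sum_comm (f := fun i j =>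
    Complex.normSq (Y i j) * b i), Finset.mul_sum, Finset.mul_sum, ← Finset.sum_sub_distrib,
    ← Finset.sum_sub_distrib]
  refine Finset.sum_congr rfl fun i _ => ?_
  rw [Finset.mul_sum, Finset.mul_sum, ← Finset.sum_sub_distrib, ← Finset.sum_sub_distrib]
  refine Finset.sum_congr rfl fun j _ => ?_
  rw [conjTranspose_apply, Complex.star_def, Complex.normSq_conj]
  ring

theorem resolventForm_le (hA : IsDiagonalizedBy A U a) (hB : IsDiagonalizedBy B W b) {t : ℝ}
    (ht : 0 < t) (X : Matrix n n ℂ) :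
    resolventForm t A B X ≤ ∑ i, ∑ j, overlap U W i j * (a i ^ 2 / (b j + t * a i)) := by
  have hX : X = W * (Wᴴ * X * U) * Uᴴ := by
    have hU : U * Uᴴ = 1 := mul_eq_one_comm.1 hA.conjTranspose_mul_self
    have hW : W * Wᴴ = 1 := mul_eq_one_comm.1 hB.conjTranspose_mul_self
    rw [Matrix.mul_assoc, Matrix.mul_assoc, hU, Matrix.mul_one, ← Matrix.mul_assoc, hW,
      Matrix.one_mul]
  rw [hX, hA.resolventForm_conj hB]
  refine Finset.sum_le_sum fun i _ => Finset.sum_le_sum fun j _ => ?_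
  generalize (Wᴴ * X * U) j i = y
  unfold overlap
  generalize (Uᴴ * W) i j = z
  have hai := hA.eigenvalues_nonneg i
  have hbj := hB.eigenvalues_nonneg j
  rcases (add_nonneg hbj (mul_nonneg ht.le hai)).eq_or_lt with h0 | h0
  · have : a i = 0 := by nlinarith [mul_nonneg ht.le hai]
    simpa [this] using mul_nonneg (Complex.normSq_nonneg y) hbj
  · rw [← mul_div_assoc, le_div_iff₀ h0]
    simp only [Complex.normSq_apply, Complex.mul_re]
    nlinarith [sq_nonneg (z.re * a i - (b j + t * a i) * y.re),
      sq_nonneg (z.im * a i + (b j + t * a i) * y.im)]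

theorem exists_resolventForm_eq (hA : IsDiagonalizedBy A U a) (hB : IsDiagonalizedBy B W b) {t : ℝ}
    (ht : 0 < t) :
    ∃ X, resolventForm t A B X = ∑ i, ∑ j, overlap U W i j * (a i ^ 2 / (b j + t * a i)) := by
  refine ⟨W * Matrix.of (fun j i =>
    star ((Uᴴ * W) i j) * ((a i / (b j + t * a i) : ℝ) : ℂ)) * Uᴴ, ?_⟩
  rw [hA.resolventForm_conj hB]
  refine Finset.sum_congr rfl fun i _ => Finset.sum_congr rfl fun j _ => ?_
  rw [Matrix.of_apply]
  unfold overlap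
  generalize (Uᴴ * W) i j = z
  have hai := hA.eigenvalues_nonneg i
  have hbj := hB.eigenvalues_nonneg j
  rcases (add_nonneg hbj (mul_nonneg ht.le hai)).eq_or_lt with h0 | h0
  · simp [← h0]
  · rw [← _root_.mul_assoc, Complex.star_def, Complex.mul_conj, ← Complex.ofReal_mul,
      Complex.ofReal_re, Complex.normSq_mul, Complex.normSq_conj, Complex.normSq_ofReal]
    field_simp
    ring

theorem overlap_mul_eq_zero (hA : IsDiagonalizedBy A U a) (hB : IsDiagonalizedBy B W b)
    (hker : ∀ v, B *ᵥ v = 0 → A *ᵥ v = 0) {i j : n} (hj : b j = 0) :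
    overlap U W i j * a i = 0 := by
  have h1 : B *ᵥ (W *ᵥ Pi.single j 1) = 0 := by
    rw [hB.eq_conj, mulVec_mulVec, Matrix.mul_assoc, hB.conjTranspose_mul_self, Matrix.mul_one,
      ← mulVec_mulVec]
    have : diagonal (fun i => (b i : ℂ)) *ᵥ Pi.single j 1 = 0 := by
      ext k
      simp only [mulVec_diagonal, Pi.zero_apply]
      rcases eq_or_ne k j with rfl | h <;> simp [*]
    rw [this, mulVec_zero]
  have h2 := congrArg (Uᴴ *ᵥ ·) (hker _ h1)
  simp only [mulVec_zero] at h2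
  simp only [hA.eq_conj, mulVec_mulVec, Matrix.mul_assoc] at h2
  rw [← Matrix.mul_assoc Uᴴ U, hA.conjTranspose_mul_self, Matrix.one_mul] at h2
  have h3 := congrFun h2 i
  rw [mulVec_single_one, Matrix.col_apply, Matrix.diagonal_mul, Pi.zero_apply, mul_eq_zero] at h3
  rcases h3 with h3 | h3
  · rw [Complex.ofReal_eq_zero.1 h3, mul_zero]
  · rw [overlap, h3, map_zero, zero_mul]

theorem smul (hA : IsDiagonalizedBy A U a) {c : ℝ} (hc : 0 ≤ c) :
    IsDiagonalizedBy (c • A) U (fun i => c * a i) where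
  conjTranspose_mul_self := hA.conjTranspose_mul_self
  eigenvalues_nonneg i := mul_nonneg hc (hA.eigenvalues_nonneg i)
  eq_conj := by
    have : diagonal (fun i => ((c * a i : ℝ) : ℂ)) = c • diagonal (fun i => (a i : ℂ)) := by
      ext i j
      simp [diagonal_apply]
    rw [this, Matrix.mul_smul, Matrix.smul_mul, ← hA.eq_conj]

theorem trace_re (hA : IsDiagonalizedBy A U a) : A.trace.re = ∑ i, a i := by
  rw [hA.eq_conj, Matrix.mul_assoc, Matrix.trace_mul_comm, Matrix.mul_assoc,
    hA.conjTranspose_mul_self, Matrix.mul_one]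
  simp [Matrix.trace]

theorem sum_overlap_mul (hA : IsDiagonalizedBy A U a) (hB : IsDiagonalizedBy B W b)
    (f : n → ℝ) : ∑ i, ∑ j, overlap U W i j * f i = ∑ i, f i := by
  simp only [← Finset.sum_mul,
    sum_overlap hA.conjTranspose_mul_self hB.conjTranspose_mul_self, one_mul]

end IsDiagonalizedBy

/-- Data processing: an instrument does not increase the total relative entropy, expressed through
eigenvalues and overlaps of arbitrary diagonalisations. -/
theorem sum_overlap_entropy_kraus_le {Ω K : Type*} [Fintype Ω] [Fintype K]
    (V : Ω → K → Matrix n n ℂ) (hV : ∑ ω, ∑ k, (V ω k)ᴴ * V ω k = 1)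
    {A B U W : Matrix n n ℂ} {a b : n → ℝ}
    (hA : IsDiagonalizedBy A U a) (hB : IsDiagonalizedBy B W b)
    (hAp : A.PosSemidef) (hBp : B.PosSemidef) (hker : ∀ v, B *ᵥ v = 0 → A *ᵥ v = 0)
    {U' W' : Ω → Matrix n n ℂ} {a' b' : Ω → n → ℝ}
    (hA' : ∀ ω, IsDiagonalizedBy (∑ k, V ω k * A * (V ω k)ᴴ) (U' ω) (a' ω))
    (hB' : ∀ ω, IsDiagonalizedBy (∑ k, V ω k * B * (V ω k)ᴴ) (W' ω) (b' ω))
    (hker' : ∀ ω v, (∑ k, V ω k * B * (V ω k)ᴴ) *ᵥ v = 0 →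
      (∑ k, V ω k * A * (V ω k)ᴴ) *ᵥ v = 0) :
    ∑ ω, ∑ i, ∑ j, overlap (U' ω) (W' ω) i j * a' ω i *
        (Real.log (a' ω i) - Real.log (b' ω j)) ≤
      ∑ i, ∑ j, overlap U W i j * a i * (Real.log (a i) - Real.log (b j)) := by
  have key := sum_entropy_le_of_sum_resolvent_le
    (I := n × n) (J := Ω × n × n)
    (fun x => overlap U W x.1 x.2) (fun x => a x.1) (fun x => b x.2)
    (fun x => overlap (U' x.1) (W' x.1) x.2.1 x.2.2) (fun x => a' x.1 x.2.1)
    (fun x => b' x.1 x.2.2)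
    (fun x => hA.eigenvalues_nonneg _)
    (fun x hx => (hB.eigenvalues_nonneg _).lt_of_ne'
      fun h => hx (hA.overlap_mul_eq_zero hB hker h))
    (fun x => (hA' _).eigenvalues_nonneg _)
    (fun x hx => ((hB' _).eigenvalues_nonneg _).lt_of_ne'
      fun h => hx ((hA' _).overlap_mul_eq_zero (hB' _) (hker' _) h)) ?_ ?_
  · simpa only [Fintype.sum_prod_type] using key
  · simp only [Fintype.sum_prod_type]
    rw [hA.sum_overlap_mul hB]
    simp only [(hA' _).sum_overlap_mul (hB' _)]
    simp only [← (hA' _).trace_re, ← hA.trace_re]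
    rw [← Complex.re_sum, ← Matrix.trace_sum]
    have : (∑ ω, ∑ k, V ω k * A * (V ω k)ᴴ).trace =
        ((∑ ω, ∑ k, (V ω k)ᴴ * V ω k) * A).trace := by
      simp only [Finset.sum_mul, Matrix.trace_sum]
      refine Finset.sum_congr rfl fun ω _ => Finset.sum_congr rfl fun k _ => ?_
      rw [Matrix.trace_mul_comm, Matrix.mul_assoc]
    rw [this, hV, Matrix.one_mul]
  · intro t ht
    simp only [Fintype.sum_prod_type]
    choose Y hY using fun ω => (hA' ω).exists_resolventForm_eq (hB' ω) ht
    simp only [← hY, resolventForm_sum]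
    rw [← Fintype.sum_prod_type'
      (f := fun ω k => resolventForm t (V ω k * A * (V ω k)ᴴ) (V ω k * B * (V ω k)ᴴ) (Y ω))]
    exact (sum_resolventForm_kraus_le (fun x : Ω × K => V x.1 x.2) (fun x => Y x.1)
      (by rwa [Fintype.sum_prod_type]) ht.le hAp hBp).trans (hA.resolventForm_le hB ht _)

end Variational

theorem mulVec_kraus_eq_zero {n K : Type*} [Fintype n] [Fintype K] (V : K → Matrix n n ℂ)
    (ρ : Matrix n n ℂ) {φ : Matrix n n ℂ} (hφ : φ.PosDef) (v : n → ℂ)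
    (hv : (∑ k, V k * φ * (V k)ᴴ) *ᵥ v = 0) : (∑ k, V k * ρ * (V k)ᴴ) *ᵥ v = 0 := by
  have h1 : ∑ k, star ((V k)ᴴ *ᵥ v) ⬝ᵥ (φ *ᵥ ((V k)ᴴ *ᵥ v)) = 0 := by
    have h2 : star v ⬝ᵥ ((∑ k, V k * φ * (V k)ᴴ) *ᵥ v) = 0 := by rw [hv, dotProduct_zero]
    rw [Matrix.sum_mulVec, dotProduct_sum] at h2
    rw [← h2]
    refine Finset.sum_congr rfl fun k _ => ?_
    rw [Matrix.star_mulVec, conjTranspose_conjTranspose, ← dotProduct_mulVec, mulVec_mulVec,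
      mulVec_mulVec, Matrix.mul_assoc]
  rw [Finset.sum_eq_zero_iff_of_nonneg
    fun k _ => hφ.posSemidef.dotProduct_mulVec_nonneg _] at h1
  rw [Matrix.sum_mulVec]
  refine Finset.sum_eq_zero fun k hk => ?_
  have h3 : (V k)ᴴ *ᵥ v = 0 := by
    by_contra h
    exact (hφ.dotProduct_mulVec_pos h).ne' (h1 k hk)
  rw [← mulVec_mulVec, h3, mulVec_zero]

section Entropy

variable {d : ℕ}

theorem Matrix.PosSemidef.isDiagonalizedBy {A : Matrix (Fin d) (Fin d) ℂ} (hA : A.PosSemidef) :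
    IsDiagonalizedBy A (hA.isHermitian.eigenvectorUnitary : Matrix (Fin d) (Fin d) ℂ)
      hA.isHermitian.eigenvalues where
  conjTranspose_mul_self := Unitary.coe_star_mul_self hA.isHermitian.eigenvectorUnitary
  eigenvalues_nonneg := hA.eigenvalues_nonneg
  eq_conj := by
    conv_lhs => rw [hA.isHermitian.spectral_theorem, Unitary.conjStarAlgAut_apply]
    rfl

theorem qRelEntropy_eq_sum_overlap {A B : Matrix (Fin d) (Fin d) ℂ} (hA : A.PosSemidef)
    (hB : B.PosSemidef) :
    qRelEntropy A B = ∑ i, ∑ j, overlap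
      (hA.isHermitian.eigenvectorUnitary : Matrix (Fin d) (Fin d) ℂ)
      (hB.isHermitian.eigenvectorUnitary : Matrix (Fin d) (Fin d) ℂ) i j *
        hA.isHermitian.eigenvalues i *
        (Real.log (hA.isHermitian.eigenvalues i) - Real.log (hB.isHermitian.eigenvalues j)) := by
  have hAd := hA.isDiagonalizedBy
  have hBd := hB.isDiagonalizedBy
  rw [qRelEntropy, matLog, matLog, dif_pos hA.isHermitian, dif_pos hB.isHermitian]
  set U : Matrix (Fin d) (Fin d) ℂ := hA.isHermitian.eigenvectorUnitary.1
  set W : Matrix (Fin d) (Fin d) ℂ := hB.isHermitian.eigenvectorUnitary.1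
  set a := hA.isHermitian.eigenvalues
  set b := hB.isHermitian.eigenvalues
  have h1 : (A * (U * diagonal (fun i => (Real.log (a i) : ℂ)) * Uᴴ)).trace.re =
      ∑ i, a i * Real.log (a i) := by
    have : A * (U * diagonal (fun i => (Real.log (a i) : ℂ)) * Uᴴ) =
        U * diagonal (fun i => ((a i * Real.log (a i) : ℝ) : ℂ)) * Uᴴ := by
      conv_lhs => rw [hAd.eq_conj]
      rw [Matrix.mul_assoc, Matrix.mul_assoc U (diagonal _) Uᴴ, ← Matrix.mul_assoc Uᴴ U,
        hAd.conjTranspose_mul_self, Matrix.one_mul, ← Matrix.mul_assoc, Matrix.mul_assoc U,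
        diagonal_mul_diagonal]
      simp only [Complex.ofReal_mul]
    rw [this, Matrix.mul_assoc, Matrix.trace_mul_comm, Matrix.mul_assoc,
      hAd.conjTranspose_mul_self, Matrix.mul_one]
    simp [Matrix.trace]
  have h2 : (A * (W * diagonal (fun i => (Real.log (b i) : ℂ)) * Wᴴ)).trace.re =
      ∑ i, ∑ j, overlap U W i j * a i * Real.log (b j) := by
    conv_lhs => rw [hAd.eq_conj]
    exact trace_conj_diagonal_mul U W a _
  simp only [star_eq_conjTranspose]
  rw [Matrix.mul_sub, Matrix.trace_sub, Complex.sub_re, h1, h2, ← hAd.sum_overlap_mul hBd]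
  simp only [mul_sub, Finset.sum_sub_distrib, mul_assoc]

variable {Ω K : Type*} [Fintype K]

theorem outcomeProb_eq_trace_instrOp (V : Ω → K → Matrix (Fin d) (Fin d) ℂ)
    (ρ : Matrix (Fin d) (Fin d) ℂ) (ω : Ω) :
    outcomeProb V ρ ω = (instrOp V ω ρ).trace.re := by
  rw [outcomeProb, instrPOV, instrOp, Finset.sum_mul, Matrix.trace_sum, Matrix.trace_sum]
  congr 1
  refine Finset.sum_congr rfl fun k _ => ?_
  rw [Matrix.mul_assoc, Matrix.trace_mul_comm]

variable (V : Ω → K → Matrix (Fin d) (Fin d) ℂ) {ρ φ : Matrix (Fin d) (Fin d) ℂ} (ω : Ω)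

theorem instrOp_posSemidef (hρ : ρ.PosSemidef) : (instrOp V ω ρ).PosSemidef :=
  posSemidef_sum _ fun k _ => hρ.mul_mul_conjTranspose_same (V ω k)

theorem outcomeProb_nonneg (hρ : ρ.PosSemidef) : 0 ≤ outcomeProb V ρ ω := by
  rw [outcomeProb_eq_trace_instrOp]
  exact (Complex.le_def.1 (instrOp_posSemidef V ω hρ).trace_nonneg).1

theorem postState_posSemidef (hρ : ρ.PosSemidef) : (postState V ρ ω).PosSemidef :=
  (instrOp_posSemidef V ω hρ).smul (inv_nonneg.2 (outcomeProb_nonneg V ω hρ))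

theorem outcomeProb_smul_postState (hρ : ρ.PosSemidef) :
    outcomeProb V ρ ω • postState V ρ ω = instrOp V ω ρ := by
  rcases eq_or_ne (outcomeProb V ρ ω) 0 with h | h
  · have hpos := instrOp_posSemidef V ω hρ
    rw [h, zero_smul, eq_comm, ← hpos.trace_eq_zero_iff]
    refine Complex.ext ?_ ?_
    · rw [← outcomeProb_eq_trace_instrOp, h, Complex.zero_re]
    · exact (Complex.le_def.1 hpos.trace_nonneg).2.symm
  · rw [postState, smul_smul, mul_inv_cancel₀ h, one_smul]

/-- The unnormalised relative entropy of the outputs for one outcome splits into a classical and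
a quantum part. -/
theorem outcomeProb_mul_qRelEntropy_postState (hρ : ρ.PosSemidef) (hφ : φ.PosDef)
    (hp : 0 < outcomeProb V ρ ω) :
    outcomeProb V ρ ω * Real.log (outcomeProb V ρ ω / outcomeProb V φ ω) +
        outcomeProb V ρ ω * qRelEntropy (postState V ρ ω) (postState V φ ω) =
      ∑ i, ∑ j, overlap
        ((postState_posSemidef V ω hρ).isHermitian.eigenvectorUnitary : Matrix (Fin d) (Fin d) ℂ)
        ((postState_posSemidef V ω hφ.posSemidef).isHermitian.eigenvectorUnitary :
          Matrix (Fin d) (Fin d) ℂ) i j *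
        (outcomeProb V ρ ω * (postState_posSemidef V ω hρ).isHermitian.eigenvalues i) *
        (Real.log (outcomeProb V ρ ω * (postState_posSemidef V ω hρ).isHermitian.eigenvalues i) -
          Real.log (outcomeProb V φ ω *
            (postState_posSemidef V ω hφ.posSemidef).isHermitian.eigenvalues j)) := by
  have hq0 := outcomeProb_nonneg V ω hφ.posSemidef
  have hA := (postState_posSemidef V ω hρ).isDiagonalizedBy
  have hB := (postState_posSemidef V ω hφ.posSemidef).isDiagonalizedBy
  have hA' := hA.smul hp.le
  have hB' := hB.smul hq0
  rw [outcomeProb_smul_postState V ω hρ] at hA'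
  rw [outcomeProb_smul_postState V ω hφ.posSemidef] at hB'
  have hsum := hA'.sum_overlap_mul hB' (fun i => outcomeProb V ρ ω *
    (postState_posSemidef V ω hρ).isHermitian.eigenvalues i)
  rw [← hA'.trace_re, ← outcomeProb_eq_trace_instrOp] at hsum
  have hzero := fun i j => hA'.overlap_mul_eq_zero hB'
    (mulVec_kraus_eq_zero (V ω) ρ hφ) (i := i) (j := j)
  rw [qRelEntropy_eq_sum_overlap (postState_posSemidef V ω hρ)
    (postState_posSemidef V ω hφ.posSemidef)]
  set U : Matrix (Fin d) (Fin d) ℂ :=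
    (postState_posSemidef V ω hρ).isHermitian.eigenvectorUnitary.1
  set W : Matrix (Fin d) (Fin d) ℂ :=
    (postState_posSemidef V ω hφ.posSemidef).isHermitian.eigenvectorUnitary.1
  set a := (postState_posSemidef V ω hρ).isHermitian.eigenvalues
  set b := (postState_posSemidef V ω hφ.posSemidef).isHermitian.eigenvalues
  set p := outcomeProb V ρ ω
  set q := outcomeProb V φ ω
  conv_lhs =>
    enter [1, 1]
    rw [← hsum]
  simp only [Finset.sum_mul, Finset.mul_sum, ← Finset.sum_add_distrib]
  refine Finset.sum_congr rfl fun i _ => Finset.sum_congr rfl fun j _ => ?_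
  by_cases h : overlap U W i j * (p * a i) = 0
  · have h' : overlap U W i j * a i = 0 := by
      have : p * (overlap U W i j * a i) = 0 := by linarith
      exact (mul_eq_zero.1 this).resolve_left hp.ne'
    rw [h, h']
    ring
  · have hqb : q * b j ≠ 0 := fun h0 => h (hzero i j h0)
    have hpa : p * a i ≠ 0 := right_ne_zero_of_mul h
    rw [Real.log_div hp.ne' (left_ne_zero_of_mul hqb),
      Real.log_mul hp.ne' (right_ne_zero_of_mul hpa),
      Real.log_mul (left_ne_zero_of_mul hqb) (right_ne_zero_of_mul hqb)]
    ring

end Entropy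

/-- fundamental inequality for an instrument viewed as a channel. -/
theorem instrument_relative_entropy_bound {d : ℕ} (hd : 1 ≤ d)
    {Ω K : Type*} [Fintype Ω] [Fintype K]
    (V : Ω → K → Matrix (Fin d) (Fin d) ℂ)
    (hV : ∑ ω, instrPOV V ω = 1)
    (ρ φ : Matrix (Fin d) (Fin d) ℂ)
    (hρ : ρ.PosSemidef) (hρtr : ρ.trace = 1)
    (hφ : φ.PosDef) (hφtr : φ.trace = 1) :
    qRelEntropy ρ φ ≥
      cRelEntropy (outcomeProb V ρ) (outcomeProb V φ) +
        ∑ ω ∈ Finset.univ.filter (fun ω => 0 < outcomeProb V ρ ω),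
          outcomeProb V ρ ω * qRelEntropy (postState V ρ ω) (postState V φ ω) := by
  have hker : ∀ v, φ *ᵥ v = 0 → ρ *ᵥ v = 0 := by
    intro v hv
    have hv0 : v = 0 := by
      by_contra h
      exact (hφ.dotProduct_mulVec_pos h).ne' (by rw [hv, dotProduct_zero])
    rw [hv0, mulVec_zero]
  have hA' : ∀ ω, _ := fun ω => outcomeProb_smul_postState V ω hρ ▸
    (postState_posSemidef V ω hρ).isDiagonalizedBy.smul (outcomeProb_nonneg V ω hρ)
  have hB' : ∀ ω, _ := fun ω => outcomeProb_smul_postState V ω hφ.posSemidef ▸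
    (postState_posSemidef V ω hφ.posSemidef).isDiagonalizedBy.smul
      (outcomeProb_nonneg V ω hφ.posSemidef)
  have key := sum_overlap_entropy_kraus_le V hV hρ.isDiagonalizedBy
    hφ.posSemidef.isDiagonalizedBy hρ hφ.posSemidef hker hA' hB'
    (fun ω => mulVec_kraus_eq_zero (V ω) ρ hφ)
  rw [← qRelEntropy_eq_sum_overlap hρ hφ.posSemidef] at key
  refine le_trans (le_of_eq ?_) key
  rw [cRelEntropy, ← Finset.sum_add_distrib, Finset.sum_filter]
  refine Finset.sum_congr rfl fun ω _ => ?_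
  split_ifs with hp
  · exact outcomeProb_mul_qRelEntropy_postState V ω hρ hφ hp
  · rw [le_antisymm (not_lt.1 hp) (outcomeProb_nonneg V ω hρ)]
    simp
end

section
/- Let E be a POV measure with finite outcome set Ω on M_d, i.e., E(ω) ≥ 0 and Σ_{ω∈Ω} E(ω) = 1. Let ρ be a density matrix and φ a positive definite density matrix, and set p_ρ(ω) = Tr(E(ω)ρ), p_φ(ω) = Tr(E(ω)φ). Then S_q(ρ‖φ) ≥ S_c(p_ρ‖p_φ). -/
open Matrix Finset
open scoped BigOperators ComplexOrder

section ScalarComparison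

open Filter Topology

lemma hasDerivAt_mul_sub_mul_log {a b T : ℝ} (ha : 0 ≤ a) (hb : 0 ≤ b) (hab : b = 0 → a = 0)
    (hT : 0 < T) :
    HasDerivAt (fun T : ℝ => T * b - a * Real.log (a + T * b)) (T * (b ^ 2 / (a + T * b))) T := by
  rcases hb.eq_or_lt with h | h
  · obtain rfl := h.symm
    obtain rfl := hab rfl
    simpa using hasDerivAt_const T (0 : ℝ)
  · have hpos : 0 < a + T * b := by positivity
    have h1 : HasDerivAt (fun T : ℝ => T * b) b T := by
      simpa using (hasDerivAt_id T).mul_const b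
    have h2 := h1.sub (((h1.const_add a).log hpos.ne').const_mul a)
    refine h2.congr_deriv ?_
    field_simp
    ring

lemma continuousAt_mul_sub_mul_log {a b : ℝ} :
    ContinuousAt (fun T : ℝ => T * b - a * Real.log (a + T * b)) 0 := by
  by_cases h : a = 0
  · subst h
    simp only [zero_mul, sub_zero]
    fun_prop
  · have : a + 0 * b ≠ 0 := by simpa using h
    fun_prop (disch := assumption)

lemma tendsto_mul_log_sub {a b : ℝ} (hb : 0 ≤ b) (hab : b = 0 → a = 0) :
    Tendsto (fun T : ℝ => a * Real.log (a + T * b) - a * Real.log T) atTop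
      (𝓝 (a * Real.log b)) := by
  rcases hb.eq_or_lt with h | h
  · obtain rfl := h.symm
    obtain rfl := hab rfl
    simp
  · have h1 : Tendsto (fun T : ℝ => a / T + b) atTop (𝓝 (0 + b)) :=
      (tendsto_const_nhds.div_atTop tendsto_id).add_const b
    rw [zero_add] at h1
    have h2 := (h1.log h.ne').const_mul a
    refine h2.congr' ?_
    have h3 : ∀ᶠ T : ℝ in atTop, 0 < a / T + b := h1.eventually (lt_mem_nhds h)
    filter_upwards [h3, eventually_gt_atTop 0] with T hT hT0
    have : a + T * b = T * (a / T + b) := by field_simp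
    rw [this, Real.log_mul hT0.ne' hT.ne']
    ring

/-- Comparison of two weighted relative entropies from the comparison of the resolvent sums
`∑ b² / (a + s b)`. -/
lemma sum_relEntropy_le_of_resolvent_le {I J : Type*} [Fintype I] [Fintype J]
    {p q : J → ℝ} {c a b : I → ℝ}
    (hp : ∀ j, 0 ≤ p j) (hq : ∀ j, 0 ≤ q j) (hpq : ∀ j, q j = 0 → p j = 0)
    (ha : ∀ i, 0 ≤ a i) (hb : ∀ i, 0 < b i)
    (hsum₁ : ∑ i, c i * a i = ∑ j, p j) (hsum₂ : ∑ i, c i * b i = ∑ j, q j)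
    (hres : ∀ s : ℝ, 0 < s →
      ∑ j, q j ^ 2 / (p j + s * q j) ≤ ∑ i, c i * (b i ^ 2 / (a i + s * b i))) :
    ∑ j, p j * (Real.log (p j) - Real.log (q j)) ≤
      ∑ i, c i * (a i * (Real.log (a i) - Real.log (b i))) := by
  set G : ℝ → ℝ := fun T =>
    ∑ i, c i * (T * b i - a i * Real.log (a i + T * b i)) -
      ∑ j, (T * q j - p j * Real.log (p j + T * q j)) with hG
  have hderiv : ∀ T, 0 < T → HasDerivAt G
      (∑ i, c i * (T * (b i ^ 2 / (a i + T * b i))) -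
        ∑ j, T * (q j ^ 2 / (p j + T * q j))) T := fun T hT =>
    (HasDerivAt.fun_sum fun i _ => (hasDerivAt_mul_sub_mul_log (ha i) (hb i).le
      (fun h => absurd h (hb i).ne') hT).const_mul (c i)).sub
    (HasDerivAt.fun_sum fun j _ => hasDerivAt_mul_sub_mul_log (hp j) (hq j) (hpq j) hT)
  have hcont0 : ContinuousAt G 0 :=
    (tendsto_finsetSum _ fun i _ => continuousAt_mul_sub_mul_log.const_mul (c i)).sub
      (tendsto_finsetSum _ fun j _ => continuousAt_mul_sub_mul_log)
  have hmono : MonotoneOn G (Set.Ici 0) := by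
    refine monotoneOn_of_hasDerivWithinAt_nonneg (convex_Ici 0) ?_
      (fun x hx => (hderiv x (by simpa using hx)).hasDerivWithinAt) ?_
    · intro x hx
      rcases (Set.mem_Ici.mp hx).eq_or_lt with h | h
      · exact h ▸ hcont0.continuousWithinAt
      · exact (hderiv x h).continuousAt.continuousWithinAt
    · intro x hx
      have hx0 : 0 < x := by simpa using hx
      have h1 := mul_le_mul_of_nonneg_left (hres x hx0) hx0.le
      rw [Finset.mul_sum, Finset.mul_sum] at h1
      rw [sub_nonneg]
      refine h1.trans_eq (Finset.sum_congr rfl fun i _ => by ring)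
  have hlim : Tendsto (fun T : ℝ =>
      ∑ j, (p j * Real.log (p j + T * q j) - p j * Real.log T) -
      ∑ i, c i * (a i * Real.log (a i + T * b i) - a i * Real.log T)) atTop
      (𝓝 (∑ j, p j * Real.log (q j) - ∑ i, c i * (a i * Real.log (b i)))) :=
    (tendsto_finsetSum _ fun j _ => tendsto_mul_log_sub (hq j) (hpq j)).sub
      (tendsto_finsetSum _ fun i _ => (tendsto_mul_log_sub (hb i).le
        (fun h => absurd h (hb i).ne')).const_mul (c i))
  have hGeq : ∀ T, G T = ∑ j, (p j * Real.log (p j + T * q j) - p j * Real.log T) -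
      ∑ i, c i * (a i * Real.log (a i + T * b i) - a i * Real.log T) := by
    intro T
    have e1 : ∑ i, c i * (T * b i) = T * ∑ j, q j := by
      rw [← hsum₂, Finset.mul_sum]; exact Finset.sum_congr rfl fun i _ => by ring
    have e2 : ∑ i, c i * (a i * Real.log T) = (∑ j, p j) * Real.log T := by
      rw [← hsum₁, Finset.sum_mul]; exact Finset.sum_congr rfl fun i _ => by ring
    simp only [hG, mul_sub, Finset.sum_sub_distrib, e1, e2, Finset.mul_sum, Finset.sum_mul]
    ring
  have hle : G 0 ≤ ∑ j, p j * Real.log (q j) - ∑ i, c i * (a i * Real.log (b i)) := by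
    refine ge_of_tendsto hlim ?_
    filter_upwards [eventually_ge_atTop 0] with T hT
    rw [← hGeq]
    exact hmono Set.self_mem_Ici hT hT
  simp only [hG, zero_mul, add_zero, zero_sub, mul_neg, Finset.sum_neg_distrib] at hle
  simp only [mul_sub, Finset.sum_sub_distrib]
  linarith

end ScalarComparison

section MatrixInequalities

variable {d : ℕ}

lemma re_trace_spectral_mul_spectral (U V : Matrix (Fin d) (Fin d) ℂ) (f g : Fin d → ℝ) :
    (trace ((U * diagonal (fun i => (f i : ℂ)) * star U) *
      (V * diagonal (fun i => (g i : ℂ)) * star V))).re =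
      ∑ x : Fin d × Fin d, Complex.normSq ((star U * V) x.1 x.2) * (f x.1 * g x.2) := by
  have h : trace ((U * diagonal (fun i => (f i : ℂ)) * star U) *
      (V * diagonal (fun i => (g i : ℂ)) * star V)) =
      trace ((diagonal (fun i => (f i : ℂ)) * (star U * V)) *
        (diagonal (fun i => (g i : ℂ)) * star (star U * V))) := by
    rw [star_mul, star_star]
    simp only [Matrix.mul_assoc]
    rw [Matrix.trace_mul_comm U]
    simp only [Matrix.mul_assoc]
  rw [h, Fintype.sum_prod_type, Matrix.trace, Complex.re_sum]
  refine Finset.sum_congr rfl fun i _ => ?_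
  rw [Matrix.diag_apply, Matrix.mul_apply, Complex.re_sum]
  refine Finset.sum_congr rfl fun j _ => ?_
  rw [Matrix.diagonal_mul, Matrix.diagonal_mul, Matrix.star_apply]
  generalize (star U * V) i j = z
  simp [Complex.normSq_apply]
  ring

open scoped MatrixOrder Matrix.Norms.L2Operator in
lemma re_trace_mul_nonneg {A B : Matrix (Fin d) (Fin d) ℂ} (hA : A.PosSemidef)
    (hB : B.PosSemidef) : 0 ≤ (trace (A * B)).re := by
  obtain ⟨C, rfl⟩ := CStarAlgebra.nonneg_iff_eq_star_mul_self.mp hB.nonneg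
  rw [Matrix.star_eq_conjTranspose]
  rw [← Matrix.mul_assoc, Matrix.trace_mul_comm, ← Matrix.mul_assoc]
  exact (Complex.nonneg_iff.mp (hA.mul_mul_conjTranspose_same C).trace_nonneg).1

open scoped MatrixOrder Matrix.Norms.L2Operator in
lemma posSemidef_eq_zero_of_re_trace_mul_eq_zero {A B : Matrix (Fin d) (Fin d) ℂ}
    (hA : A.PosSemidef) (hB : B.PosDef) (h : (trace (A * B)).re = 0) : A = 0 := by
  obtain ⟨C, rfl⟩ := CStarAlgebra.nonneg_iff_eq_star_mul_self.mp hA.nonneg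
  rw [Matrix.star_eq_conjTranspose] at h ⊢
  have hP := hB.posSemidef.mul_mul_conjTranspose_same C
  have h0 : trace (C * B * Cᴴ) = 0 := by
    apply Complex.ext
    · rw [Matrix.trace_mul_comm, ← Matrix.mul_assoc, h]; rfl
    · exact (Complex.nonneg_iff.mp hP.trace_nonneg).2.symm
  have h1 := (hP.trace_eq_zero_iff).mp h0
  have h2 : Cᴴ = 0 := by
    ext i j
    have hx := congrFun (congrFun h1 j) j
    by_contra hne
    have hv : (fun i => Cᴴ i j) ≠ 0 := fun hz => hne (congrFun hz i)
    have := hB.dotProduct_mulVec_pos hv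
    refine this.ne' (Eq.trans ?_ hx)
    rw [Matrix.mul_assoc, Matrix.mul_apply]
    simp [dotProduct, Matrix.mulVec, Matrix.mul_apply]
  rw [h2, Matrix.zero_mul]

/-- Operator Jensen inequality for the square: `(∑ x E)² ≤ ∑ x² E`, tested against a state. -/
lemma re_trace_sq_povSum_le {Ω : Type*} [Fintype Ω]
    {E : Ω → Matrix (Fin d) (Fin d) ℂ} (hEpos : ∀ ω, (E ω).PosSemidef) (hEsum : ∑ ω, E ω = 1)
    {σ : Matrix (Fin d) (Fin d) ℂ} (hσ : σ.PosSemidef) (x : Ω → ℝ) :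
    (trace (((∑ ω, (x ω : ℂ) • E ω) * ∑ ω, (x ω : ℂ) • E ω) * σ)).re ≤
      ∑ ω, x ω ^ 2 * povProb E σ ω := by
  set X := ∑ ω, (x ω : ℂ) • E ω with hX
  have hXh : Xᴴ = X := by
    simp [hX, Matrix.conjTranspose_sum, (hEpos _).isHermitian.eq]
  have hpos : ∀ ω, 0 ≤ (trace ((((x ω : ℂ) • 1 - X) * E ω * ((x ω : ℂ) • 1 - X)) * σ)).re := by
    intro ω
    have := (hEpos ω).mul_mul_conjTranspose_same ((x ω : ℂ) • 1 - X)
    refine re_trace_mul_nonneg ?_ hσ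
    simpa [hXh] using this
  have hid : ∑ ω, ((x ω : ℂ) • 1 - X) * E ω * ((x ω : ℂ) • 1 - X) =
      ∑ ω, ((x ω ^ 2 : ℝ) : ℂ) • E ω - X * X := by
    have e : ∀ ω, ((x ω : ℂ) • 1 - X) * E ω * ((x ω : ℂ) • 1 - X) =
        ((x ω ^ 2 : ℝ) : ℂ) • E ω - ((x ω : ℂ) • E ω) * X - X * ((x ω : ℂ) • E ω)
          + X * E ω * X := by
      intro ω
      simp only [sub_mul, mul_sub, Matrix.smul_mul, Matrix.mul_smul, Matrix.one_mul,
        Matrix.mul_one, Complex.ofReal_mul, pow_two, smul_smul]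
      abel
    simp only [e, Finset.sum_add_distrib, Finset.sum_sub_distrib, ← Finset.sum_mul,
      ← Finset.mul_sum, hEsum, Matrix.mul_one, ← hX]
    abel
  have h := Finset.sum_nonneg fun ω (_ : ω ∈ Finset.univ) => hpos ω
  rw [← Complex.re_sum, ← Matrix.trace_sum, ← Finset.sum_mul, hid, Matrix.sub_mul,
    Matrix.trace_sub, Complex.sub_re, Finset.sum_mul, Matrix.trace_sum, Complex.re_sum] at h
  have e2 : ∀ ω, (trace ((((x ω ^ 2 : ℝ) : ℂ) • E ω) * σ)).re = x ω ^ 2 * povProb E σ ω := by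
    intro ω
    rw [Matrix.smul_mul, Matrix.trace_smul, smul_eq_mul, Complex.re_ofReal_mul, povProb]
  simp only [e2] at h
  linarith

lemma two_mul_re_sub_le {w m : ℂ} {b t : ℝ} (ht : 0 < t) :
    2 * (b * (star w * m).re) - t * Complex.normSq m ≤ Complex.normSq w * (b ^ 2 / t) := by
  rw [mul_div_assoc', le_div_iff₀ ht]
  simp only [Complex.normSq_apply, RCLike.star_def, Complex.mul_re, Complex.conj_re,
    Complex.conj_im]
  nlinarith [sq_nonneg (t * m.re - b * w.re), sq_nonneg (t * m.im - b * w.im)]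

/-- Variational lower bound for `⟨φ, (L_ρ + s R_φ)⁻¹ φ⟩` in terms of the spectral data of
`ρ` and `φ`. -/
lemma variational_le_resolvent {U V X : Matrix (Fin d) (Fin d) ℂ}
    (hU : U * star U = 1) (hV : V * star V = 1)
    (hX : Xᴴ = X) {a b : Fin d → ℝ} (ha : ∀ i, 0 ≤ a i) (hb : ∀ i, 0 < b i)
    {s : ℝ} (hs : 0 < s) :
    2 * (trace (X * (V * diagonal (fun i => (b i : ℂ)) * star V))).re
      - (trace (X * X * (U * diagonal (fun i => (a i : ℂ)) * star U))).re
      - s * (trace (X * X * (V * diagonal (fun i => (b i : ℂ)) * star V))).re ≤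
      ∑ x : Fin d × Fin d,
        Complex.normSq ((star U * V) x.1 x.2) * (b x.2 ^ 2 / (a x.1 + s * b x.2)) := by
  set M := star U * X * V with hM
  have hstarM : star M = star V * X * U := by
    rw [hM, star_mul, star_mul, star_star, Matrix.star_eq_conjTranspose X, hX, Matrix.mul_assoc]
  have e1 : (trace (X * (V * diagonal (fun i => (b i : ℂ)) * star V))).re =
      ∑ x : Fin d × Fin d, b x.2 * (star ((star U * V) x.1 x.2) * M x.1 x.2).re := by
    have h : trace (X * (V * diagonal (fun i => (b i : ℂ)) * star V)) =
        trace ((M * diagonal (fun i => (b i : ℂ))) * star (star U * V)) := by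
      rw [star_mul, star_star, ← Matrix.mul_assoc _ (star V) U, Matrix.trace_mul_comm _ U, hM]
      simp only [← Matrix.mul_assoc, hU, Matrix.one_mul]
    rw [h, Fintype.sum_prod_type, Matrix.trace, Complex.re_sum]
    refine Finset.sum_congr rfl fun i _ => ?_
    rw [Matrix.diag_apply, Matrix.mul_apply, Complex.re_sum]
    refine Finset.sum_congr rfl fun j _ => ?_
    rw [Matrix.mul_diagonal, Matrix.star_apply, ← Complex.re_ofReal_mul]
    congr 1
    ring
  have e2 : (trace (X * X * (U * diagonal (fun i => (a i : ℂ)) * star U))).re =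
      ∑ x : Fin d × Fin d, a x.1 * Complex.normSq (M x.1 x.2) := by
    have h : trace (X * X * (U * diagonal (fun i => (a i : ℂ)) * star U)) =
        trace ((diagonal (fun i => (a i : ℂ)) * M) * star M) := by
      have : diagonal (fun i => (a i : ℂ)) * M * star M =
          diagonal (fun i => (a i : ℂ)) * (star U * X * (V * star V) * X * U) := by
        rw [hstarM, hM]; simp only [Matrix.mul_assoc]
      rw [this, hV, Matrix.mul_one, Matrix.trace_mul_comm (X * X), Matrix.mul_assoc,
        Matrix.mul_assoc, Matrix.trace_mul_comm U]
      simp only [Matrix.mul_assoc]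
    rw [h, Fintype.sum_prod_type, Matrix.trace, Complex.re_sum]
    refine Finset.sum_congr rfl fun i _ => ?_
    rw [Matrix.diag_apply, Matrix.mul_apply, Complex.re_sum]
    refine Finset.sum_congr rfl fun j _ => ?_
    rw [Matrix.diagonal_mul, Matrix.star_apply, mul_assoc, RCLike.star_def, Complex.mul_conj,
      ← Complex.ofReal_mul, Complex.ofReal_re]
  have e3 : (trace (X * X * (V * diagonal (fun i => (b i : ℂ)) * star V))).re =
      ∑ x : Fin d × Fin d, b x.2 * Complex.normSq (M x.1 x.2) := by
    have h : trace (X * X * (V * diagonal (fun i => (b i : ℂ)) * star V)) =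
        trace ((M * diagonal (fun i => (b i : ℂ))) * star M) := by
      rw [hstarM, ← Matrix.mul_assoc _ _ U, Matrix.trace_mul_comm _ U, hM, Matrix.mul_assoc X X,
        Matrix.trace_mul_comm X]
      simp only [← Matrix.mul_assoc, hU, Matrix.one_mul]
    rw [h, Fintype.sum_prod_type, Matrix.trace, Complex.re_sum]
    refine Finset.sum_congr rfl fun i _ => ?_
    rw [Matrix.diag_apply, Matrix.mul_apply, Complex.re_sum]
    refine Finset.sum_congr rfl fun j _ => ?_
    rw [Matrix.mul_diagonal, Matrix.star_apply, mul_right_comm, RCLike.star_def,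
      Complex.mul_conj, ← Complex.ofReal_mul, Complex.ofReal_re, mul_comm]
  rw [e1, e2, e3, Finset.mul_sum, Finset.mul_sum, ← Finset.sum_sub_distrib,
    ← Finset.sum_sub_distrib]
  refine Finset.sum_le_sum fun x _ => ?_
  have ht : 0 < a x.1 + s * b x.2 := by have := ha x.1; have := hb x.2; positivity
  refine le_trans (le_of_eq ?_) (two_mul_re_sub_le (m := M x.1 x.2) ht)
  ring

end MatrixInequalities

/-- monotonicity of relative entropy under the POV-measure channel. -/
theorem pov_relative_entropy_bound {d : ℕ} (hd : 1 ≤ d)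
    {Ω : Type*} [Fintype Ω]
    (E : Ω → Matrix (Fin d) (Fin d) ℂ)
    (hEpos : ∀ ω, (E ω).PosSemidef) (hEsum : ∑ ω, E ω = 1)
    (ρ φ : Matrix (Fin d) (Fin d) ℂ)
    (hρ : ρ.PosSemidef) (hρtr : ρ.trace = 1)
    (hφ : φ.PosDef) (hφtr : φ.trace = 1) :
    qRelEntropy ρ φ ≥ cRelEntropy (povProb E ρ) (povProb E φ) := by
  set U := (hρ.isHermitian.eigenvectorUnitary : Matrix (Fin d) (Fin d) ℂ)
  set V := (hφ.isHermitian.eigenvectorUnitary : Matrix (Fin d) (Fin d) ℂ)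
  set a := hρ.isHermitian.eigenvalues
  set b := hφ.isHermitian.eigenvalues
  have hU : U * star U = 1 := Unitary.coe_mul_star_self _
  have hV : V * star V = 1 := Unitary.coe_mul_star_self _
  have ha : ∀ i, 0 ≤ a i := hρ.eigenvalues_nonneg
  have hb : ∀ i, 0 < b i := hφ.eigenvalues_pos
  have hρU : ρ = U * diagonal (fun i => (a i : ℂ)) * star U := by
    simpa [Unitary.conjStarAlgAut_apply, Function.comp_def] using hρ.isHermitian.spectral_theorem
  have hφV : φ = V * diagonal (fun i => (b i : ℂ)) * star V := by
    simpa [Unitary.conjStarAlgAut_apply, Function.comp_def] using hφ.isHermitian.spectral_theorem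
  have hlogρ : matLog ρ = U * diagonal (fun i => (Real.log (a i) : ℂ)) * star U :=
    dif_pos hρ.isHermitian
  have hlogφ : matLog φ = V * diagonal (fun i => (Real.log (b i) : ℂ)) * star V :=
    dif_pos hφ.isHermitian
  have hU' : star U * U = 1 := Unitary.coe_star_mul_self _
  have honeU : U * diagonal (fun _ => ((1 : ℝ) : ℂ)) * star U = 1 := by simp [hU]
  have honeV : V * diagonal (fun _ => ((1 : ℝ) : ℂ)) * star V = 1 := by simp [hV]
  have htotal : ∀ {σ : Matrix (Fin d) (Fin d) ℂ}, σ.trace = 1 → ∑ ω, povProb E σ ω = 1 := by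
    intro σ hσ
    simp only [povProb]
    rw [← Complex.re_sum, ← Matrix.trace_sum, ← Finset.sum_mul, hEsum, Matrix.one_mul, hσ,
      Complex.one_re]
  have hp : ∀ ω, 0 ≤ povProb E ρ ω := fun ω => re_trace_mul_nonneg (hEpos ω) hρ
  have hq : ∀ ω, 0 ≤ povProb E φ ω := fun ω => re_trace_mul_nonneg (hEpos ω) hφ.posSemidef
  have hpq : ∀ ω, povProb E φ ω = 0 → povProb E ρ ω = 0 := by
    intro ω h
    simp [povProb, posSemidef_eq_zero_of_re_trace_mul_eq_zero (hEpos ω) hφ h]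
  have hquantum : qRelEntropy ρ φ =
      ∑ x : Fin d × Fin d, Complex.normSq ((star U * V) x.1 x.2) *
        (a x.1 * (Real.log (a x.1) - Real.log (b x.2))) := by
    have h1 : (trace (ρ * matLog ρ)).re = ∑ x : Fin d × Fin d,
        Complex.normSq ((star U * V) x.1 x.2) * (a x.1 * Real.log (a x.1) * 1) := by
      rw [← re_trace_spectral_mul_spectral U V (fun i => a i * Real.log (a i)) (fun _ => 1),
        honeV, Matrix.mul_one, hlogρ]
      nth_rewrite 1 [hρU]
      have : U * diagonal (fun i => (a i : ℂ)) * star U *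
          (U * diagonal (fun i => (Real.log (a i) : ℂ)) * star U) =
          U * (diagonal (fun i => (a i : ℂ)) * (star U * U) *
            diagonal (fun i => (Real.log (a i) : ℂ))) * star U := by
        simp only [Matrix.mul_assoc]
      rw [this, hU', Matrix.mul_one, Matrix.diagonal_mul_diagonal]
      simp only [Complex.ofReal_mul]
    have h2 : (trace (ρ * matLog φ)).re = ∑ x : Fin d × Fin d,
        Complex.normSq ((star U * V) x.1 x.2) * (a x.1 * Real.log (b x.2)) := by
      rw [← re_trace_spectral_mul_spectral U V a (fun i => Real.log (b i)), hlogφ, ← hρU]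
    rw [qRelEntropy, Matrix.mul_sub, Matrix.trace_sub, Complex.sub_re, h1, h2,
      ← Finset.sum_sub_distrib]
    exact Finset.sum_congr rfl fun x _ => by ring
  have hclassical : cRelEntropy (povProb E ρ) (povProb E φ) =
      ∑ ω, povProb E ρ ω * (Real.log (povProb E ρ ω) - Real.log (povProb E φ ω)) := by
    rw [cRelEntropy, Finset.sum_filter]
    refine Finset.sum_congr rfl fun ω _ => ?_
    split_ifs with h
    · rw [Real.log_div h.ne' fun h0 => h.ne' (hpq ω h0)]
    · rw [le_antisymm (not_lt.mp h) (hp ω), zero_mul]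
  rw [ge_iff_le, hquantum, hclassical]
  refine sum_relEntropy_le_of_resolvent_le (a := fun x : Fin d × Fin d => a x.1)
    (b := fun x : Fin d × Fin d => b x.2) hp hq hpq (fun x => ha x.1) (fun x => hb x.2) ?_ ?_ ?_
  · have := re_trace_spectral_mul_spectral U V a (fun _ => 1)
    rw [honeV, Matrix.mul_one, ← hρU, hρtr, Complex.one_re] at this
    simpa [htotal hρtr] using this.symm
  · have := re_trace_spectral_mul_spectral U V (fun _ => 1) b
    rw [honeU, Matrix.one_mul, ← hφV, hφtr, Complex.one_re] at this
    simpa [htotal hφtr] using this.symm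
  · intro s hs
    set y : Ω → ℝ := fun ω => povProb E φ ω / (povProb E ρ ω + s * povProb E φ ω) with hy
    have hXh : (∑ ω, (y ω : ℂ) • E ω)ᴴ = ∑ ω, (y ω : ℂ) • E ω := by
      simp [Matrix.conjTranspose_sum, (hEpos _).isHermitian.eq]
    have hvar := variational_le_resolvent hU hV hXh ha hb hs
    rw [← hρU, ← hφV] at hvar
    have hJρ := re_trace_sq_povSum_le hEpos hEsum hρ y
    have hJφ := mul_le_mul_of_nonneg_left
      (re_trace_sq_povSum_le hEpos hEsum hφ.posSemidef y) hs.le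
    have hlin : (trace ((∑ ω, (y ω : ℂ) • E ω) * φ)).re = ∑ ω, y ω * povProb E φ ω := by
      rw [Finset.sum_mul, Matrix.trace_sum, Complex.re_sum]
      refine Finset.sum_congr rfl fun ω _ => ?_
      rw [Matrix.smul_mul, Matrix.trace_smul, smul_eq_mul, Complex.re_ofReal_mul, povProb]
    have hval : ∑ ω, povProb E φ ω ^ 2 / (povProb E ρ ω + s * povProb E φ ω) =
        2 * ∑ ω, y ω * povProb E φ ω - ∑ ω, y ω ^ 2 * povProb E ρ ω -
          s * ∑ ω, y ω ^ 2 * povProb E φ ω := by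
      rw [Finset.mul_sum, Finset.mul_sum, ← Finset.sum_sub_distrib, ← Finset.sum_sub_distrib]
      refine Finset.sum_congr rfl fun ω _ => ?_
      rcases (hq ω).eq_or_lt with h | h
      · simp [hy, ← h]
      · have hden : povProb E ρ ω + s * povProb E φ ω ≠ 0 := by
          have := hp ω
          positivity
        have hz : y ω * (povProb E ρ ω + s * povProb E φ ω) = povProb E φ ω :=
          div_mul_cancel₀ _ hden
        have hsq : povProb E φ ω ^ 2 / (povProb E ρ ω + s * povProb E φ ω) =
            y ω * povProb E φ ω := by
          rw [pow_two, mul_div_right_comm]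
        linear_combination hsq + y ω * hz
    rw [hval, ← hlin]
    linarith
end
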